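/- arXiv:2604.22211 — 2 statements merged into one kernel-verified Lean document; each statement's English description precedes it below -/
import Mathlib

section
/- Let α ∈ (1,2). There exists a constant C > 0, depending only on α, such that the Mittag-Leffler function satisfies the decay estimate |E_{α,2}(−x)| ≤ C/(1 + x) for all x ≥ 0. -/
/-- The two-parameter Mittag-Leffler function `E_{α,β}(z) = Σ_{n=0}^∞ z^n / Γ(nα + β)`. -/
noncomputable def mittagLeffler2 (α β z : ℝ) : ℝ :=
  ∑' n : ℕ, z ^ n / Real.Gamma ((n : ℝ) * α + β)

open MeasureTheory Complex

theorem aestronglyMeasurable_cpow_mul_exp_neg_mul (a r : ℂ) :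
    AEStronglyMeasurable (fun t : ℝ ↦ (t : ℂ) ^ a * exp (-(r * t)))
      (volume.restrict (Set.Ioi 0)) := by
  refine ContinuousOn.aestronglyMeasurable (fun t ht ↦ ?_) measurableSet_Ioi
  refine ContinuousAt.continuousWithinAt ?_
  refine ContinuousAt.mul (ContinuousAt.cpow (by fun_prop) continuousAt_const ?_) (by fun_prop)
  simpa [mem_slitPlane_iff] using ht

theorem norm_cpow_mul_exp_neg_mul (a r : ℂ) {t : ℝ} (ht : 0 < t) :
    ‖(t : ℂ) ^ a * exp (-(r * t))‖ = t ^ a.re * Real.exp (-r.re * t ^ (1 : ℝ)) := by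
  rw [norm_mul, norm_cpow_eq_rpow_re_of_pos ht, norm_exp]
  simp

theorem integrableOn_cpow_mul_exp_neg_mul {a r : ℂ} (ha : -1 < a.re) (hr : 0 < r.re) :
    IntegrableOn (fun t : ℝ ↦ (t : ℂ) ^ a * exp (-(r * t))) (Set.Ioi 0) := by
  refine (integrableOn_rpow_mul_exp_neg_mul_rpow (p := 1) ha one_pos hr).mono'
    (aestronglyMeasurable_cpow_mul_exp_neg_mul a r) ?_
  filter_upwards [ae_restrict_mem measurableSet_Ioi] with t ht
  exact (norm_cpow_mul_exp_neg_mul a r ht).le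

theorem differentiableAt_integral_cpow_mul_exp_neg_mul {a r : ℂ} (ha : -1 < a.re)
    (hr : 0 < r.re) :
    DifferentiableAt ℂ (fun r : ℂ ↦ ∫ t : ℝ in Set.Ioi 0, (t : ℂ) ^ a * exp (-(r * t))) r := by
  refine (hasDerivAt_integral_of_dominated_loc_of_deriv_le
    (F' := fun w (t : ℝ) ↦ -((t : ℂ) ^ (a + 1) * exp (-(w * t))))
    (bound := fun t : ℝ ↦ t ^ (a.re + 1) * Real.exp (-(r.re / 2) * t ^ (1 : ℝ)))
    (s := {w : ℂ | r.re / 2 < w.re})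
    ((isOpen_lt continuous_const continuous_re).mem_nhds (by simpa using hr))
    (.of_forall fun w ↦ aestronglyMeasurable_cpow_mul_exp_neg_mul a w)
    (integrableOn_cpow_mul_exp_neg_mul ha hr)
    (aestronglyMeasurable_cpow_mul_exp_neg_mul (a + 1) r).neg ?_
    (integrableOn_rpow_mul_exp_neg_mul_rpow (by linarith) one_pos (by linarith))
    ?_).2.differentiableAt
  · filter_upwards [ae_restrict_mem measurableSet_Ioi] with t ht w hw
    have ht : 0 < t := ht
    have hw : r.re / 2 < w.re := hw
    rw [norm_neg, norm_cpow_mul_exp_neg_mul _ _ ht]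
    simp only [add_re, one_re, Real.rpow_one]
    gcongr
  · filter_upwards [ae_restrict_mem measurableSet_Ioi] with t ht w hw
    have ht0 : (t : ℂ) ≠ 0 := by exact_mod_cast (ne_of_gt ht)
    have h : HasDerivAt (fun w : ℂ ↦ -(w * t)) (-(1 * (t : ℂ))) w :=
      ((hasDerivAt_id w).mul_const (t : ℂ)).neg
    convert! (h.cexp).const_mul ((t : ℂ) ^ a) using 1
    rw [cpow_add _ _ ht0, cpow_one]
    ring

/-- The Gamma integral with a complex rate `r` in the right half-plane. -/
theorem integral_cpow_mul_exp_neg_mul_Ioi_of_re_pos {a r : ℂ} (ha : 0 < a.re) (hr : 0 < r.re) :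
    ∫ t : ℝ in Set.Ioi 0, (t : ℂ) ^ (a - 1) * exp (-(r * t)) = r ^ (-a) * Gamma a := by
  have hopen : IsOpen {w : ℂ | 0 < w.re} := isOpen_lt continuous_const continuous_re
  have hleft : AnalyticOnNhd ℂ
      (fun r : ℂ ↦ ∫ t : ℝ in Set.Ioi 0, (t : ℂ) ^ (a - 1) * exp (-(r * t)))
      {w : ℂ | 0 < w.re} :=
    DifferentiableOn.analyticOnNhd (fun w hw ↦
      (differentiableAt_integral_cpow_mul_exp_neg_mul (by simpa using ha)
        hw).differentiableWithinAt) hopen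
  have hright : AnalyticOnNhd ℂ (fun r : ℂ ↦ r ^ (-a) * Gamma a) {w : ℂ | 0 < w.re} :=
    DifferentiableOn.analyticOnNhd (fun w hw ↦ ((differentiableAt_id.cpow_const
      (.inl hw)).mul_const _).differentiableWithinAt) hopen
  refine hleft.eqOn_of_preconnected_of_frequently_eq hright
    (convex_halfSpace_re_gt 0).isPreconnected (z₀ := 1) (by simp) ?_ hr
  have htend : Filter.Tendsto (fun x : ℝ ↦ (x : ℂ)) (nhdsWithin 1 {1}ᶜ) (nhdsWithin 1 {1}ᶜ) := by
    refine tendsto_nhdsWithin_iff.2 ⟨?_, ?_⟩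
    · exact (continuous_ofReal.tendsto' 1 1 (by simp)).mono_left nhdsWithin_le_nhds
    · filter_upwards [self_mem_nhdsWithin] with x hx
      simpa using hx
  refine htend.frequently (Filter.Eventually.frequently ?_)
  filter_upwards [nhdsWithin_le_nhds (Ioi_mem_nhds (zero_lt_one' ℝ))] with x hx
  rw [integral_cpow_mul_exp_neg_mul_Ioi ha hx, one_div, inv_cpow, cpow_neg]
  rw [arg_ofReal_of_nonneg (le_of_lt hx)]
  exact Real.pi_pos.ne

theorem norm_add_mul_I_cpow_le {c s : ℝ} (hc : 1 ≤ c) (hs : 0 ≤ s) (y : ℝ) :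
    ‖((c : ℂ) + y * I) ^ (-s : ℂ)‖ ≤ (1 + ‖y‖ ^ 2) ^ (-s / 2) := by
  have hz : (c : ℂ) + y * I ≠ 0 := fun h ↦ by
    have := congrArg Complex.re h
    simp at this
    linarith
  have h1 : (1 + ‖y‖ ^ 2) ^ (1 / 2 : ℝ) ≤ ‖(c : ℂ) + y * I‖ := by
    rw [← Real.sqrt_eq_rpow, norm_add_mul_I]
    apply Real.sqrt_le_sqrt
    rw [Real.norm_eq_abs, sq_abs]
    nlinarith
  have h2 : (1 + ‖y‖ ^ 2) ^ (-s / 2) = ((1 + ‖y‖ ^ 2) ^ (1 / 2 : ℝ)) ^ (-s) := by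
    rw [← Real.rpow_mul (by positivity)]
    ring_nf
  rw [norm_cpow_of_ne_zero hz, h2]
  simp only [neg_re, ofReal_re, neg_im, ofReal_im, neg_zero, mul_zero, Real.exp_zero, div_one]
  exact Real.rpow_le_rpow_of_nonpos (by positivity) h1 (by linarith)

theorem add_mul_I_mem_slitPlane {c : ℝ} (hc : 0 < c) (y : ℝ) :
    (c : ℂ) + y * I ∈ slitPlane := by
  simp [mem_slitPlane_iff, hc]

theorem integrable_add_mul_I_cpow {c s : ℝ} (hc : 1 ≤ c) (hs : 1 < s) :
    Integrable fun y : ℝ ↦ ((c : ℂ) + y * I) ^ (-s : ℂ) := by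
  refine (integrable_rpow_neg_one_add_norm_sq (E := ℝ) (r := s) (by simpa using hs)).mono'
    (Continuous.aestronglyMeasurable ?_) (.of_forall fun y ↦
      norm_add_mul_I_cpow_le hc (by linarith) y)
  exact Continuous.cpow (by fun_prop) continuous_const
    fun y ↦ add_mul_I_mem_slitPlane (by linarith) y

/-- Laplace's integral for the reciprocal Gamma function. -/
theorem integral_exp_mul_cpow_vertical {c s : ℝ} (hc : 1 ≤ c) (hs : 1 < s) :
    ∫ y : ℝ, exp ((c : ℂ) + y * I) * ((c : ℂ) + y * I) ^ (-s : ℂ) =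
      2 * Real.pi / Real.Gamma s := by
  have hc0 : 0 < c := by linarith
  have hΓ : (Real.Gamma s : ℂ) ≠ 0 := by
    exact_mod_cast (Real.Gamma_pos_of_pos (by linarith)).ne'
  set f : ℝ → ℂ := (Set.Ioi 0).indicator
    fun t : ℝ ↦ (t : ℂ) ^ ((s : ℂ) - 1) * exp (-(c * t)) with hf
  have hfi : Integrable f := by
    rw [hf, integrable_indicator_iff measurableSet_Ioi]
    exact integrableOn_cpow_mul_exp_neg_mul (by simpa using by linarith) (by simpa using hc0)
  have hF : FourierTransform.fourier f = fun w : ℝ ↦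
      ((c : ℂ) + (2 * Real.pi * w : ℝ) * I) ^ (-s : ℂ) * Real.Gamma s := by
    funext w
    have hr : 0 < ((c : ℂ) + (2 * Real.pi * w : ℝ) * I).re := by simpa using hc0
    rw [← Complex.Gamma_ofReal, ← integral_cpow_mul_exp_neg_mul_Ioi_of_re_pos
      (by simpa using by linarith) hr, Real.fourier_real_eq_integral_exp_smul,
      ← integral_indicator measurableSet_Ioi]
    congr 1
    funext t
    by_cases ht : t ∈ Set.Ioi 0
    · simp only [hf, Set.indicator_of_mem ht, smul_eq_mul]
      rw [mul_left_comm, ← exp_add]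
      push_cast
      ring_nf
    · simp [hf, Set.indicator_of_notMem ht]
  have hFi : Integrable (FourierTransform.fourier f) := by
    rw [hF]
    exact ((integrable_add_mul_I_cpow hc hs).comp_mul_left' (R := 2 * Real.pi)
      (by positivity)).mul_const _
  have hcont : ContinuousAt f 1 := by
    have : (fun t : ℝ ↦ (t : ℂ) ^ ((s : ℂ) - 1) * exp (-(c * t))) =ᶠ[nhds 1] f := by
      filter_upwards [Ioi_mem_nhds (zero_lt_one' ℝ)] with t ht
      simp only [hf, Set.indicator_of_mem ht]
    refine ContinuousAt.congr ?_ this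
    refine ContinuousAt.mul (ContinuousAt.cpow ?_ continuousAt_const ?_) ?_
    · fun_prop
    · simp
    · fun_prop
  have hinv := hfi.fourierInv_fourier_eq hFi hcont
  rw [hF, Real.fourierInv_eq'] at hinv
  have hsub := Measure.integral_comp_mul_left
    (fun y : ℝ ↦ exp (y * I) * (((c : ℂ) + y * I) ^ (-s : ℂ) * Real.Gamma s)) (2 * Real.pi)
  have hf1 : f 1 = exp (-c) := by simp [hf]
  simp only [smul_eq_mul, RCLike.inner_apply, conj_trivial, one_mul] at hinv
  rw [hinv, hf1, abs_of_pos (by positivity)] at hsub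
  simp_rw [exp_add, mul_assoc]
  rw [integral_const_mul]
  simp_rw [← mul_assoc] at hsub
  rw [integral_mul_const, exp_neg] at hsub
  have hπ : (Real.pi : ℂ) ≠ 0 := by exact_mod_cast Real.pi_ne_zero
  rw [real_smul] at hsub
  push_cast at hsub
  have he := exp_ne_zero (c : ℂ)
  rw [eq_div_iff hΓ]
  field_simp at hsub
  rw [hsub]

/-- The Laplace transform of `t ↦ t * E_{α,2}(-x t ^ α)`. -/
noncomputable def mittagLefflerSymbol (α x : ℝ) (z : ℂ) : ℂ :=
  z ^ ((α : ℂ) - 2) / (z ^ (α : ℂ) + x)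

theorem integrable_exp_mul_cpow_vertical {c s : ℝ} (hc : 1 ≤ c) (hs : 1 < s) :
    Integrable fun y : ℝ ↦ exp ((c : ℂ) + y * I) * ((c : ℂ) + y * I) ^ (-s : ℂ) := by
  refine (integrable_add_mul_I_cpow hc hs).bdd_mul (c := Real.exp c) ?_ ?_
  · exact (Continuous.cexp (by fun_prop)).aestronglyMeasurable
  · exact .of_forall fun y ↦ by simp [norm_exp]

theorem exists_mul_le_norm_cpow_add {α : ℝ} (hα : α ∈ Set.Ioo (1 : ℝ) 2) :
    ∃ κ : ℝ, 0 < κ ∧ ∀ z : ℂ, 0 < z.re → ∀ x : ℝ, 0 ≤ x →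
      κ * ‖z‖ ^ α ≤ ‖z ^ (α : ℂ) + x‖ ∧ κ * x ≤ ‖z ^ (α : ℂ) + x‖ := by
  obtain ⟨h1, h2⟩ := hα
  have hπ := Real.pi_pos
  set m := -Real.cos (Real.pi / 2 * α) with hm
  have hm1 : m < 1 := by
    have : Real.cos Real.pi < Real.cos (Real.pi / 2 * α) :=
      Real.cos_lt_cos_of_nonneg_of_le_pi (by positivity) le_rfl (by nlinarith)
    rw [Real.cos_pi] at this
    linarith
  have hm0 : 0 ≤ m := by
    have := Real.cos_nonpos_of_pi_div_two_le_of_le (x := Real.pi / 2 * α)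
      (by nlinarith) (by nlinarith)
    linarith
  refine ⟨√(1 - m), Real.sqrt_pos.2 (by linarith), fun z hz x hx ↦ ?_⟩
  have harg : |z.arg| < Real.pi / 2 := abs_arg_lt_pi_div_two_iff.2 (.inl hz)
  have hcos : -m ≤ Real.cos (z.arg * α) := by
    rw [hm, neg_neg, ← Real.cos_abs (z.arg * α), abs_mul, abs_of_pos (by linarith : 0 < α)]
    exact Real.cos_le_cos_of_nonneg_of_le_pi (by positivity) (by nlinarith) (by nlinarith)
  have hn : 0 ≤ ‖z‖ ^ α := by positivity
  have hre : -m * ‖z‖ ^ α ≤ (z ^ (α : ℂ)).re := by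
    rw [cpow_ofReal_re]
    nlinarith
  have hsq : (1 - m) * ((‖z‖ ^ α) ^ 2 + x ^ 2) ≤ ‖z ^ (α : ℂ) + x‖ ^ 2 := by
    have hw : (‖z‖ ^ α) ^ 2 = (z ^ (α : ℂ)).re ^ 2 + (z ^ (α : ℂ)).im ^ 2 := by
      rw [← norm_cpow_real, Complex.sq_norm, normSq_apply]
      ring
    have hx2 : ‖z ^ (α : ℂ) + x‖ ^ 2 = (‖z‖ ^ α) ^ 2 + 2 * x * (z ^ (α : ℂ)).re + x ^ 2 := by
      rw [hw, Complex.sq_norm, normSq_apply]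
      simp
      ring
    rw [hx2]
    nlinarith [mul_le_mul_of_nonneg_left hre hx, mul_nonneg hm0 (sq_nonneg (‖z‖ ^ α - x))]
  have hs : √(1 - m) ^ 2 = 1 - m := Real.sq_sqrt (by linarith)
  constructor <;> refine (sq_le_sq₀ (by positivity) (norm_nonneg _)).1 ?_ <;> rw [mul_pow, hs] <;>
    nlinarith [sq_nonneg x, sq_nonneg (‖z‖ ^ α)]

theorem add_mul_I_ne_zero {c : ℝ} (hc : 0 < c) (y : ℝ) : (c : ℂ) + y * I ≠ 0 :=
  slitPlane_ne_zero (add_mul_I_mem_slitPlane hc y)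

theorem cpow_neg_natCast_mul_add_two {z : ℂ} (hz : z ≠ 0) (α : ℝ) (n : ℕ) :
    z ^ (-((n * α + 2 : ℝ) : ℂ)) = (z ^ (-α : ℂ)) ^ n * z ^ (-(2 : ℝ) : ℂ) := by
  rw [← cpow_nat_mul, ← cpow_add _ _ hz]
  push_cast
  ring_nf

theorem norm_neg_mul_cpow_le {α x c : ℝ} (hα : 0 < α) (hx : 0 ≤ x) (hc : 1 ≤ c) (y : ℝ) :
    ‖(-x : ℂ) * ((c : ℂ) + y * I) ^ (-α : ℂ)‖ ≤ x / c ^ α := by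
  have hc0 : 0 < c := by linarith
  have hle : c ≤ ‖(c : ℂ) + y * I‖ := by simpa using re_le_norm ((c : ℂ) + y * I)
  rw [norm_mul, norm_neg, Complex.norm_of_nonneg hx, ← ofReal_neg, norm_cpow_real, div_eq_mul_inv,
    ← Real.rpow_neg hc0.le]
  exact mul_le_mul_of_nonneg_left
    (Real.rpow_le_rpow_of_nonpos hc0 hle (by linarith)) hx

theorem hasSum_mittagLefflerSymbol {α x c : ℝ} (hα : 0 < α) (hx : 0 ≤ x) (hc : 1 ≤ c)
    (hxc : x < c ^ α) (y : ℝ) :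
    HasSum (fun n : ℕ ↦ (-x : ℂ) ^ n * ((c : ℂ) + y * I) ^ (-((n * α + 2 : ℝ) : ℂ)))
      (mittagLefflerSymbol α x ((c : ℂ) + y * I)) := by
  have hc0 : 0 < c := by linarith
  have hz := add_mul_I_ne_zero hc0 y
  have hlt := (norm_neg_mul_cpow_le hα hx hc y).trans_lt ((div_lt_one (by positivity)).2 hxc)
  have hne : 1 - (-x : ℂ) * ((c : ℂ) + y * I) ^ (-α : ℂ) ≠ 0 := fun h ↦ by
    rw [← sub_eq_zero.1 h] at hlt
    simp at hlt
  convert! (hasSum_geometric_of_norm_lt_one hlt).mul_right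
    (((c : ℂ) + y * I) ^ (-(2 : ℝ) : ℂ)) using 1
  · funext n
    rw [cpow_neg_natCast_mul_add_two hz, mul_pow, mul_assoc]
  · set z := (c : ℂ) + y * I
    have hzα : z ^ (α : ℂ) ≠ 0 := by simp [cpow_eq_zero_iff, hz]
    have hden : z ^ (α : ℂ) + x = z ^ (α : ℂ) * (1 - (-x : ℂ) * z ^ (-α : ℂ)) := by
      rw [cpow_neg]
      field_simp
      ring
    rw [mittagLefflerSymbol, hden, sub_eq_add_neg, cpow_add _ _ hz]
    push_cast
    field_simp

theorem integral_exp_mul_mittagLefflerSymbol {α x c : ℝ} (hα : 0 < α) (hx : 0 ≤ x) (hc : 1 ≤ c)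
    (hxc : x < c ^ α) :
    ∫ y : ℝ, exp ((c : ℂ) + y * I) * mittagLefflerSymbol α x ((c : ℂ) + y * I) =
      2 * Real.pi * mittagLeffler2 α 2 (-x) := by
  have hc0 : 0 < c := by linarith
  have hs (n : ℕ) : 1 < n * α + 2 := by
    have : 0 ≤ n * α := by positivity
    linarith
  set F : ℕ → ℝ → ℂ := fun n y ↦ (-x : ℂ) ^ n *
    (exp ((c : ℂ) + y * I) * ((c : ℂ) + y * I) ^ (-((n * α + 2 : ℝ) : ℂ))) with hF
  have hint (n : ℕ) : Integrable (F n) :=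
    (integrable_exp_mul_cpow_vertical hc (hs n)).const_mul _
  have hq : x / c ^ α < 1 := (div_lt_one (by positivity)).2 hxc
  have hbound (n : ℕ) (y : ℝ) : ‖F n y‖ ≤
      (x / c ^ α) ^ n * ‖exp ((c : ℂ) + y * I) * ((c : ℂ) + y * I) ^ (-(2 : ℝ) : ℂ)‖ := by
    have h : F n y = ((-x : ℂ) * ((c : ℂ) + y * I) ^ (-α : ℂ)) ^ n *
        (exp ((c : ℂ) + y * I) * ((c : ℂ) + y * I) ^ (-(2 : ℝ) : ℂ)) := by
      simp only [hF]
      rw [cpow_neg_natCast_mul_add_two (add_mul_I_ne_zero hc0 y)]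
      ring
    rw [h, norm_mul, norm_pow]
    gcongr
    exact norm_neg_mul_cpow_le hα hx hc y
  have hint2 := integrable_exp_mul_cpow_vertical hc one_lt_two
  have hsum : Summable fun n ↦ ∫ y, ‖F n y‖ := by
    refine Summable.of_nonneg_of_le (fun n ↦ integral_nonneg fun y ↦ norm_nonneg _) (fun n ↦ ?_)
      ((summable_geometric_of_lt_one (by positivity) hq).mul_right
        (∫ y : ℝ, ‖exp ((c : ℂ) + y * I) * ((c : ℂ) + y * I) ^ (-(2 : ℝ) : ℂ)‖))
    rw [← integral_const_mul]
    exact integral_mono (hint n).norm (hint2.norm.const_mul _) (hbound n)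
  have htsum (y : ℝ) : ∑' n, F n y =
      exp ((c : ℂ) + y * I) * mittagLefflerSymbol α x ((c : ℂ) + y * I) := by
    rw [← ((hasSum_mittagLefflerSymbol hα hx hc hxc y).mul_left _).tsum_eq]
    exact tsum_congr fun n ↦ by simp only [hF]; ring
  have hval (n : ℕ) : ∫ y, F n y =
      2 * Real.pi * (((-x) ^ n / Real.Gamma (n * α + 2) : ℝ) : ℂ) := by
    simp only [hF]
    rw [integral_const_mul, integral_exp_mul_cpow_vertical hc (hs n)]
    push_cast
    ring
  have := (hasSum_integral_of_summable_integral_norm hint hsum).tsum_eq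
  simp_rw [htsum, hval] at this
  rw [← this, tsum_mul_left, mittagLeffler2, ofReal_tsum]

/-- The complex derivative of `mittagLefflerSymbol α x`. -/
noncomputable def mittagLefflerSymbolDeriv (α x : ℝ) (z : ℂ) : ℂ :=
  ((α : ℂ) - 2) * z ^ ((α : ℂ) - 3) / (z ^ (α : ℂ) + x) -
    α * z ^ (2 * (α : ℂ) - 3) / (z ^ (α : ℂ) + x) ^ 2

theorem hasDerivAt_mittagLefflerSymbol {α x : ℝ} {z : ℂ} (hz : z ∈ slitPlane)
    (hne : z ^ (α : ℂ) + x ≠ 0) :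
    HasDerivAt (mittagLefflerSymbol α x) (mittagLefflerSymbolDeriv α x z) z := by
  have h1 := (hasDerivAt_id z).cpow_const (c := (α : ℂ) - 2) hz
  have h2 := ((hasDerivAt_id z).cpow_const (c := (α : ℂ)) hz).add_const (x : ℂ)
  convert! h1.div h2 hne using 1
  have h3 : z ^ (2 * (α : ℂ) - 3) = z ^ ((α : ℂ) - 2) * z ^ ((α : ℂ) - 1) := by
    rw [← cpow_add _ _ (slitPlane_ne_zero hz)]
    ring_nf
  have h4 : (α : ℂ) - 2 - 1 = α - 3 := by ring
  simp only [id, mul_one, mittagLefflerSymbolDeriv, h3, h4]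
  field_simp

theorem norm_mittagLefflerSymbol_le {α x κ : ℝ} {z : ℂ} (hκ : 0 < κ) (hz : z ≠ 0)
    (hD : κ * ‖z‖ ^ α ≤ ‖z ^ (α : ℂ) + x‖) :
    ‖mittagLefflerSymbol α x z‖ ≤ κ⁻¹ * ‖z ^ (-(2 : ℝ) : ℂ)‖ := by
  have hz' : 0 < ‖z‖ := norm_pos_iff.2 hz
  have hpow : ‖z ^ ((α : ℂ) - 2)‖ = ‖z‖ ^ α * ‖z ^ (-(2 : ℝ) : ℂ)‖ := by
    rw [sub_eq_add_neg, cpow_add _ _ hz, norm_mul, norm_cpow_real]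
    simp
  have hpos : 0 < ‖z‖ ^ α := by positivity
  rw [mittagLefflerSymbol, norm_div, hpow, div_le_iff₀ (by nlinarith)]
  calc ‖z‖ ^ α * ‖z ^ (-(2 : ℝ) : ℂ)‖
      = κ⁻¹ * ‖z ^ (-(2 : ℝ) : ℂ)‖ * (κ * ‖z‖ ^ α) := by field_simp
    _ ≤ _ := by gcongr

theorem norm_mittagLefflerSymbolDeriv_le {α x κ : ℝ} {z : ℂ} (hα : α ∈ Set.Ioo (1 : ℝ) 2)
    (hx : 0 ≤ x) (hκ : 0 < κ) (hz : 1 ≤ ‖z‖) (hD : κ * ‖z‖ ^ α ≤ ‖z ^ (α : ℂ) + x‖)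
    (hDx : κ * x ≤ ‖z ^ (α : ℂ) + x‖) :
    ‖mittagLefflerSymbolDeriv α x z‖ ≤
      ((2 - α + α / κ) * (2 / κ)) / (1 + x) * ‖z ^ (-(3 - α : ℝ) : ℂ)‖ := by
  obtain ⟨h1, h2⟩ := hα
  have hz0 : z ≠ 0 := norm_pos_iff.1 (by linarith)
  have hone : 1 ≤ ‖z‖ ^ α := Real.one_le_rpow hz (by linarith)
  set D := ‖z ^ (α : ℂ) + x‖ with hDdef
  set P := ‖z ^ (-(3 - α : ℝ) : ℂ)‖ with hP
  have hD0 : 0 < D := by nlinarith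
  have hDinv : 1 / D ≤ 2 / κ / (1 + x) := by
    rw [div_div, div_le_div_iff₀ hD0 (by positivity)]
    nlinarith
  have e1 : ‖z ^ ((α : ℂ) - 3)‖ = P := by
    rw [hP]
    push_cast
    ring_nf
  have e2 : ‖z ^ (2 * (α : ℂ) - 3)‖ = ‖z‖ ^ α * P := by
    rw [hP, ← norm_cpow_real, ← norm_mul, ← cpow_add _ _ hz0]
    push_cast
    ring_nf
  have hP0 : 0 ≤ P := norm_nonneg _
  have n1 : ‖(α : ℂ) - 2‖ = 2 - α := by
    rw [← ofReal_ofNat, ← ofReal_sub, norm_real, Real.norm_eq_abs, abs_of_neg] <;> linarith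
  have n2 : ‖(α : ℂ)‖ = α := Complex.norm_of_nonneg (by linarith)
  calc ‖mittagLefflerSymbolDeriv α x z‖
      ≤ (2 - α) * P / D + α * (‖z‖ ^ α * P) / D ^ 2 := by
        refine (norm_sub_le _ _).trans_eq ?_
        rw [norm_div, norm_div, norm_mul, norm_mul, norm_pow, e1, e2, n1, n2]
    _ ≤ (2 - α) * P / D + α * P / κ / D := by
        refine add_le_add le_rfl ?_
        rw [div_div, div_le_div_iff₀ (by positivity) (by positivity)]
        calc α * (‖z‖ ^ α * P) * (κ * D) = α * P * D * (κ * ‖z‖ ^ α) := by ring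
          _ ≤ α * P * D * D := by gcongr
          _ = α * P * D ^ 2 := by ring
    _ = (2 - α + α / κ) * P * (1 / D) := by field_simp
    _ ≤ (2 - α + α / κ) * P * (2 / κ / (1 + x)) := by
        have : 0 ≤ 2 - α + α / κ := add_nonneg (by linarith) (by positivity)
        gcongr
    _ = _ := by ring

theorem re_add_mul_I (c y : ℝ) : ((c : ℂ) + y * I).re = c := by simp

theorem integrable_exp_mul_mittagLefflerSymbol {α x κ c : ℝ} (hκ : 0 < κ) (hc : 1 ≤ c)
    (hD : ∀ z : ℂ, 0 < z.re → κ * ‖z‖ ^ α ≤ ‖z ^ (α : ℂ) + x‖)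
    (hdiff : ∀ z : ℂ, 0 < z.re → DifferentiableAt ℂ (mittagLefflerSymbol α x) z) :
    Integrable fun y : ℝ ↦
      exp ((c : ℂ) + y * I) * mittagLefflerSymbol α x ((c : ℂ) + y * I) := by
  have hre (y : ℝ) : 0 < ((c : ℂ) + y * I).re := by rw [re_add_mul_I]; linarith
  refine ((integrable_add_mul_I_cpow hc one_lt_two).norm.const_mul (Real.exp c * κ⁻¹)).mono'
    (Continuous.aestronglyMeasurable ?_) (.of_forall fun y ↦ ?_)
  · refine Continuous.mul (by fun_prop) (continuous_iff_continuousAt.2 fun y ↦ ?_)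
    exact ContinuousAt.comp (f := fun y : ℝ ↦ (c : ℂ) + y * I) (hdiff _ (hre y)).continuousAt
      (by fun_prop)
  · rw [norm_mul, norm_exp, re_add_mul_I, mul_assoc]
    gcongr
    exact norm_mittagLefflerSymbol_le hκ (add_mul_I_ne_zero (by linarith) y) (hD _ (hre y))

theorem integral_exp_mul_mittagLefflerSymbol_eq {α x κ c : ℝ} (hκ : 0 < κ) (hc : 1 ≤ c)
    (hD : ∀ z : ℂ, 0 < z.re → κ * ‖z‖ ^ α ≤ ‖z ^ (α : ℂ) + x‖)
    (hdiff : ∀ z : ℂ, 0 < z.re → DifferentiableAt ℂ (mittagLefflerSymbol α x) z) :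
    ∫ y : ℝ, exp ((c : ℂ) + y * I) * mittagLefflerSymbol α x ((c : ℂ) + y * I) =
      ∫ y : ℝ, exp (((1 : ℝ) : ℂ) + y * I) *
        mittagLefflerSymbol α x (((1 : ℝ) : ℂ) + y * I) := by
  set f : ℂ → ℂ := fun z ↦ exp z * mittagLefflerSymbol α x z with hf
  have hvert (b : ℝ) (hb : 1 ≤ b) : Filter.Tendsto
      (fun T : ℝ ↦ ∫ y in (-T)..T, f ((b : ℂ) + y * I)) Filter.atTop
      (nhds (∫ y : ℝ, f ((b : ℂ) + y * I))) :=
    intervalIntegral_tendsto_integral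
      (integrable_exp_mul_mittagLefflerSymbol hκ hb hD hdiff)
      Filter.tendsto_neg_atTop_atBot Filter.tendsto_id
  have hbound (T : ℝ) (u : ℝ) (hu : u ∈ Set.uIoc 1 c) (v : ℝ) (hv : |v| = |T|) :
      ‖f ((u : ℂ) + v * I)‖ ≤ Real.exp c * κ⁻¹ * (1 + T ^ 2)⁻¹ := by
    rw [Set.uIoc_of_le hc] at hu
    simp only [hf]
    rw [norm_mul, norm_exp, re_add_mul_I, mul_assoc]
    have h1 := norm_mittagLefflerSymbol_le hκ (add_mul_I_ne_zero (by linarith [hu.1]) v)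
      (hD ((u : ℂ) + v * I) (by rw [re_add_mul_I]; linarith [hu.1]))
    have h2 := norm_add_mul_I_cpow_le hu.1.le zero_le_two v
    have h3 : (1 + ‖v‖ ^ 2) ^ (-2 / 2 : ℝ) = (1 + T ^ 2)⁻¹ := by
      rw [Real.norm_eq_abs, hv, sq_abs, show (-2 / 2 : ℝ) = -1 by norm_num, Real.rpow_neg_one]
    rw [h3] at h2
    have h4 : κ⁻¹ * ‖((u : ℂ) + v * I) ^ (-(2 : ℝ) : ℂ)‖ ≤ κ⁻¹ * (1 + T ^ 2)⁻¹ := by gcongr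
    exact mul_le_mul (Real.exp_le_exp.2 hu.2) (h1.trans h4) (norm_nonneg _) (by positivity)
  have hhor (σ : ℝ) (hσ : |σ| = 1) : Filter.Tendsto
      (fun T : ℝ ↦ ∫ u in (1 : ℝ)..c, f ((u : ℂ) + (σ * T : ℝ) * I)) Filter.atTop (nhds 0) := by
    refine squeeze_zero_norm (fun T ↦ intervalIntegral.norm_integral_le_of_norm_le_const
      fun u hu ↦ hbound T u hu (σ * T) (by rw [abs_mul, hσ, one_mul])) ?_
    have : Filter.Tendsto (fun T : ℝ ↦ (1 + T ^ 2)⁻¹) Filter.atTop (nhds 0) :=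
      (Filter.tendsto_atTop_add_const_left _ _
        (Filter.tendsto_pow_atTop two_ne_zero)).inv_tendsto_atTop
    simpa using (this.const_mul (Real.exp c * κ⁻¹)).mul_const |c - 1|
  have hrect (T : ℝ) :
      (∫ u in (1 : ℝ)..c, f ((u : ℂ) + (-1 * T : ℝ) * I)) -
        (∫ u in (1 : ℝ)..c, f ((u : ℂ) + (1 * T : ℝ) * I)) +
        I * (∫ y in (-T)..T, f ((c : ℂ) + y * I)) -
        I * (∫ y in (-T)..T, f (((1 : ℝ) : ℂ) + y * I)) = 0 := by
    have := integral_boundary_rect_eq_zero_of_differentiableOn f ⟨1, -T⟩ ⟨c, T⟩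
      fun z hz ↦ by
        have hz1 : z.re ∈ Set.uIcc 1 c := hz.1
        rw [Set.uIcc_of_le hc] at hz1
        exact (differentiable_exp.differentiableAt.mul
          (hdiff z (by linarith [hz1.1]))).differentiableWithinAt
    simpa only [smul_eq_mul, neg_one_mul, one_mul] using this
  have hlim := ((((hhor (-1) (by simp)).sub (hhor 1 (by simp))).add
    ((hvert c hc).const_mul I)).sub ((hvert 1 le_rfl).const_mul I))
  simp_rw [hrect] at hlim
  have := tendsto_nhds_unique hlim tendsto_const_nhds
  rw [sub_zero, zero_add, ← mul_sub] at this
  exact sub_eq_zero.1 ((mul_eq_zero.1 this).resolve_left I_ne_zero)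

/-- Integration by parts along the line `Re z = 1`. -/
theorem integral_exp_mul_mittagLefflerSymbol_eq_neg {α x κ : ℝ} (hκ : 0 < κ)
    (hD : ∀ z : ℂ, 0 < z.re → κ * ‖z‖ ^ α ≤ ‖z ^ (α : ℂ) + x‖)
    (hderiv : ∀ z : ℂ, 0 < z.re →
      HasDerivAt (mittagLefflerSymbol α x) (mittagLefflerSymbolDeriv α x z) z)
    (hint : Integrable fun y : ℝ ↦ exp (((1 : ℝ) : ℂ) + y * I) *
      mittagLefflerSymbolDeriv α x (((1 : ℝ) : ℂ) + y * I)) :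
    ∫ y : ℝ, exp (((1 : ℝ) : ℂ) + y * I) * mittagLefflerSymbol α x (((1 : ℝ) : ℂ) + y * I) =
      -∫ y : ℝ, exp (((1 : ℝ) : ℂ) + y * I) *
        mittagLefflerSymbolDeriv α x (((1 : ℝ) : ℂ) + y * I) := by
  have hline (y : ℝ) : HasDerivAt (fun y : ℝ ↦ ((1 : ℝ) : ℂ) + y * I) I y := by
    simpa using ((hasDerivAt_id y).ofReal_comp.mul_const I).const_add ((1 : ℝ) : ℂ)
  have hsym := integrable_exp_mul_mittagLefflerSymbol hκ le_rfl hD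
    fun z hz ↦ (hderiv z hz).differentiableAt
  have key := integral_mul_deriv_eq_deriv_mul_of_integrable
    (u := fun y : ℝ ↦ exp (((1 : ℝ) : ℂ) + y * I))
    (u' := fun y : ℝ ↦ exp (((1 : ℝ) : ℂ) + y * I) * I)
    (v := fun y : ℝ ↦ mittagLefflerSymbol α x (((1 : ℝ) : ℂ) + y * I))
    (v' := fun y : ℝ ↦ mittagLefflerSymbolDeriv α x (((1 : ℝ) : ℂ) + y * I) * I)
    (fun y _ ↦ (hline y).cexp)
    (fun y _ ↦ (hderiv _ (by rw [re_add_mul_I]; exact one_pos)).comp y (hline y))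
    ((hint.mul_const I).congr (.of_forall fun y ↦ by simp only [Pi.mul_apply]; ring))
    ((hsym.mul_const I).congr (.of_forall fun y ↦ by simp only [Pi.mul_apply]; ring))
    hsym
  simp_rw [mul_right_comm _ I, ← mul_assoc] at key
  rw [integral_mul_const, integral_mul_const, ← neg_mul] at key
  rw [mul_right_cancel₀ I_ne_zero key, neg_neg]

/-- for `α ∈ (1,2)` there is a constant `C > 0`, depending only on `α`,
with `|E_{α,2}(-x)| ≤ C / (1 + x)` for all `x ≥ 0`. -/
theorem mittagLeffler_decay (α : ℝ) (hα : α ∈ Set.Ioo (1 : ℝ) 2) :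
    ∃ C : ℝ, 0 < C ∧ ∀ x : ℝ, 0 ≤ x →
      |mittagLeffler2 α 2 (-x)| ≤ C / (1 + x) := by
  obtain ⟨κ, hκ, hlow⟩ := exists_mul_le_norm_cpow_add hα
  have hα0 : 0 < α := by linarith [hα.1]
  have h3α : 1 < 3 - α := by linarith [hα.2]
  set A := (2 - α + α / κ) * (2 / κ) with hA
  have hA0 : 0 ≤ A :=
    mul_nonneg (add_nonneg (by linarith [hα.2]) (by positivity)) (by positivity)
  have hJ := integrable_exp_mul_cpow_vertical (le_refl 1) h3α
  set J := ∫ y : ℝ, ‖exp (((1 : ℝ) : ℂ) + y * I) *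
    (((1 : ℝ) : ℂ) + y * I) ^ (-(3 - α : ℝ) : ℂ)‖
  have hJ0 : 0 ≤ J := integral_nonneg fun y ↦ norm_nonneg _
  refine ⟨A * J + 1, by positivity, fun x hx ↦ ?_⟩
  have hD (z : ℂ) (hz : 0 < z.re) := (hlow z hz x hx).1
  have hne (z : ℂ) (hz : 0 < z.re) : z ^ (α : ℂ) + x ≠ 0 := by
    have : 0 < ‖z‖ := norm_pos_iff.2 (slitPlane_ne_zero (.inl hz))
    exact norm_pos_iff.1 (lt_of_lt_of_le (by positivity) (hD z hz))
  have hderiv (z : ℂ) (hz : 0 < z.re) := hasDerivAt_mittagLefflerSymbol (.inl hz) (hne z hz)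
  have hre (y : ℝ) : 0 < (((1 : ℝ) : ℂ) + y * I).re := by rw [re_add_mul_I]; exact one_pos
  have hbound (y : ℝ) : ‖exp (((1 : ℝ) : ℂ) + y * I) *
      mittagLefflerSymbolDeriv α x (((1 : ℝ) : ℂ) + y * I)‖ ≤
      A / (1 + x) * ‖exp (((1 : ℝ) : ℂ) + y * I) *
        (((1 : ℝ) : ℂ) + y * I) ^ (-(3 - α : ℝ) : ℂ)‖ := by
    rw [norm_mul, norm_mul, mul_left_comm]
    refine mul_le_mul_of_nonneg_left (norm_mittagLefflerSymbolDeriv_le hα hx hκ ?_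
      (hD _ (hre y)) (hlow _ (hre y) x hx).2) (norm_nonneg _)
    simpa using re_le_norm (((1 : ℝ) : ℂ) + y * I)
  have hmeas : AEStronglyMeasurable fun y : ℝ ↦ exp (((1 : ℝ) : ℂ) + y * I) *
      mittagLefflerSymbolDeriv α x (((1 : ℝ) : ℂ) + y * I) := by
    refine Measurable.aestronglyMeasurable ?_
    unfold mittagLefflerSymbolDeriv
    fun_prop
  have hint := (hJ.norm.const_mul (A / (1 + x))).mono' hmeas (.of_forall hbound)
  obtain ⟨c, hc, hxc⟩ : ∃ c : ℝ, 1 ≤ c ∧ x < c ^ α :=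
    ((Filter.eventually_ge_atTop 1).and
      ((tendsto_rpow_atTop hα0).eventually_gt_atTop x)).exists
  have hrep := integral_exp_mul_mittagLefflerSymbol hα0 hx hc hxc
  rw [integral_exp_mul_mittagLefflerSymbol_eq hκ hc hD
      fun z hz ↦ (hderiv z hz).differentiableAt,
    integral_exp_mul_mittagLefflerSymbol_eq_neg hκ hD hderiv hint] at hrep
  have hnorm : 2 * Real.pi * |mittagLeffler2 α 2 (-x)| ≤ A / (1 + x) * J := by
    have h := norm_integral_le_of_norm_le (hJ.norm.const_mul (A / (1 + x)))
      (.of_forall hbound)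
    rw [integral_const_mul, ← norm_neg, hrep, norm_mul, norm_mul, norm_real, norm_real,
      Real.norm_eq_abs, Real.norm_eq_abs, abs_of_pos Real.pi_pos, norm_ofNat] at h
    exact h
  calc |mittagLeffler2 α 2 (-x)|
      ≤ 2 * Real.pi * |mittagLeffler2 α 2 (-x)| :=
        le_mul_of_one_le_left (abs_nonneg _) (by linarith [Real.pi_gt_three])
    _ ≤ A / (1 + x) * J := hnorm
    _ = A * J / (1 + x) := by ring
    _ ≤ (A * J + 1) / (1 + x) := by gcongr; linarith
end

section
/- Let N ≥ 1, let A be a real N × N lower triangular matrix whose diagonal entries are all strictly positive, and let μ > 0. Then the 2N × 2N block matrix [[A, μ I_N],[I_N, −A]] (with I_N the N × N identity matrix) is invertible. -/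
/-- The diagonal of the square of a lower triangular matrix consists of the squares of the diagonal
entries. -/
theorem Matrix.mul_self_apply_self_of_lowerTriangular {n R : Type*} [Fintype n] [LinearOrder n]
    [NonUnitalNonAssocSemiring R] {A : Matrix n n R} (hA : ∀ i j, i < j → A i j = 0) (i : n) :
    (A * A) i i = A i i * A i i := by
  rw [Matrix.mul_apply]
  refine Finset.sum_eq_single i (fun k _ hk => ?_) (by simp)
  rcases lt_or_gt_of_ne hk with h | h
  · rw [hA k i h, mul_zero]
  · rw [hA i k h, zero_mul]

/-- If `A` is real lower triangular and `μ > 0`, then `A² + μI` has positive determinant. -/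
theorem Matrix.det_mul_self_add_smul_one_pos {n : Type*} [Fintype n] [LinearOrder n]
    {A : Matrix n n ℝ} (hA : ∀ i j, i < j → A i j = 0) {μ : ℝ} (hμ : 0 < μ) :
    0 < (A * A + μ • (1 : Matrix n n ℝ)).det := by
  have hT : A.IsLowerTriangular := fun i j h => hA i j h
  have hS : (A * A + μ • (1 : Matrix n n ℝ)).IsLowerTriangular := by
    rw [Matrix.smul_one_eq_diagonal]
    exact (hT.mul hT).add (Matrix.blockTriangular_diagonal _)
  rw [Matrix.det_of_isLowerTriangular _ hS]
  refine Finset.prod_pos fun i _ => ?_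
  rw [Matrix.add_apply, Matrix.mul_self_apply_self_of_lowerTriangular hA]
  simpa using add_pos_of_nonneg_of_pos (mul_self_nonneg (A i i)) hμ

/-- The square of `[[A, μI], [I, -A]]` is block diagonal with both blocks equal to `A² + μI`. -/
theorem Matrix.fromBlocks_smul_one_one_neg_mul_self {n R : Type*} [Fintype n] [DecidableEq n]
    [CommRing R] (A : Matrix n n R) (μ : R) :
    Matrix.fromBlocks A (μ • (1 : Matrix n n R)) 1 (-A) *
        Matrix.fromBlocks A (μ • (1 : Matrix n n R)) 1 (-A) =
      Matrix.fromBlocks (A * A + μ • (1 : Matrix n n R)) 0 0 (A * A + μ • (1 : Matrix n n R)) := by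
  simp [Matrix.fromBlocks_multiply, add_comm]

/-- if `A` is a real `N × N` lower triangular matrix with strictly positive
diagonal entries and `μ > 0`, then the `2N × 2N` block matrix `[[A, μI],[I, -A]]`
is invertible. -/
theorem block_matrix_invertible
    (N : ℕ) (hN : 1 ≤ N) (A : Matrix (Fin N) (Fin N) ℝ) (μ : ℝ) (hμ : 0 < μ)
    (hlow : ∀ i j : Fin N, i < j → A i j = 0)
    (hdiag : ∀ i : Fin N, 0 < A i i) :
    IsUnit (Matrix.fromBlocks A (μ • (1 : Matrix (Fin N) (Fin N) ℝ))
      (1 : Matrix (Fin N) (Fin N) ℝ) (-A)) := by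
  have hS := Matrix.det_mul_self_add_smul_one_pos hlow hμ
  have hsq := congrArg Matrix.det (Matrix.fromBlocks_smul_one_one_neg_mul_self A μ)
  rw [Matrix.det_mul, Matrix.det_fromBlocks_zero₂₁] at hsq
  rw [Matrix.isUnit_iff_isUnit_det, isUnit_iff_ne_zero]
  exact left_ne_zero_of_mul (hsq ▸ (mul_pos hS hS).ne')
end
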